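/- (Edwards, Halverson) If a locally compact metric ANR X has the disjoint homotopies property, then X × ℝ has the disjoint disks property. -/

import Mathlib

open Set Metric Topology unitInterval

/-- Absolute neighborhood retract: every closed embedding into a metric space
admits a retraction of an open neighborhood of the image onto the image. -/
def IsANR (Y : Type*) [MetricSpace Y] : Prop :=
  ∀ (Z : Type*) [MetricSpace Z] (e : Y → Z), Topology.IsClosedEmbedding e →
    ∃ (U : Set Z) (r : U → Z), IsOpen U ∧ Set.range e ⊆ U ∧ Continuous r ∧
      Set.range r ⊆ Set.range e ∧ ∀ z : U, (z : Z) ∈ Set.range e → r z = z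

/-- The closed unit 2-disk. -/
def Disk2 : Set (EuclideanSpace ℝ (Fin 2)) := Metric.closedBall 0 1

/-- The disjoint disks property. -/
def HasDDP (X : Type*) [MetricSpace X] : Prop :=
  ∀ ε : ℝ, 0 < ε → ∀ f g : C(Disk2, X), ∃ f' g' : C(Disk2, X),
    (∀ p, dist (f p) (f' p) < ε) ∧ (∀ p, dist (g p) (g' p) < ε) ∧
    Set.range f' ∩ Set.range g' = ∅

/-- The disjoint homotopies property. -/
def HasDHP (X : Type*) [MetricSpace X] : Prop :=
  ∀ ε : ℝ, 0 < ε → ∀ f g : C(unitInterval × unitInterval, X),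
    ∃ f' g' : C(unitInterval × unitInterval, X),
      (∀ p, dist (f p) (f' p) < ε) ∧ (∀ p, dist (g p) (g' p) < ε) ∧
      ∀ t s₁ s₂ : unitInterval, f' (s₁, t) ≠ g' (s₂, t)

/-- A real function `t` on `E` is a level function if it is the second coordinate of a map
`E → ℝ²` that has a continuous left inverse. -/
def IsLevelFunction {E : Type*} [TopologicalSpace E] (t : C(E, ℝ)) : Prop :=
  ∃ (h : C(E, ℝ)) (k : C(ℝ × ℝ, E)), ∀ p, k (h p, t p) = p

/-- The functions that coincide at every point with one of finitely many level functions. -/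
def piecewiseLevel (E : Type*) [TopologicalSpace E] : Set C(E, ℝ) :=
  {u | ∃ F : Finset C(E, ℝ), (∀ t ∈ F, IsLevelFunction t) ∧ ∀ p, ∃ t ∈ F, u p = t p}

theorem exists_unitInterval_chart {M : ℝ} (hM : 0 < M) :
    ∃ (γ : C(unitInterval, ℝ)) (θ : C(ℝ, unitInterval)), ∀ x, |x| ≤ M → γ (θ x) = x := by
  refine ⟨⟨fun s => M * (2 * (s : ℝ) - 1), by fun_prop⟩,
    ⟨fun x => projIcc 0 1 zero_le_one ((x / M + 1) / 2),
      continuous_projIcc.comp (by fun_prop)⟩, fun x hx => ?_⟩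
  obtain ⟨h1, h2⟩ := abs_le.1 hx
  have h3 : -1 ≤ x / M := by rw [le_div_iff₀ hM]; linarith
  have h4 : x / M ≤ 1 := by rw [div_le_iff₀ hM]; linarith
  have h5 : (x / M + 1) / 2 ∈ Icc (0 : ℝ) 1 := ⟨by linarith, by linarith⟩
  simp only [ContinuousMap.coe_mk, projIcc_of_mem _ h5]
  field_simp
  ring

theorem ContinuousMap.exists_forall_abs_le {E : Type*} [TopologicalSpace E] [CompactSpace E]
    (u : C(E, ℝ)) : ∃ M, ∀ p, |u p| ≤ M :=
  ⟨‖u‖, fun p => u.norm_coe_le_norm p⟩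

section Separation

variable {X E : Type*} [MetricSpace X] [TopologicalSpace E] [CompactSpace E]

theorem HasDHP.exists_separated (hX : HasDHP X) {ε : ℝ} (hε : 0 < ε) (f g : C(E, X))
    {t₁ t₂ : C(E, ℝ)} (ht₁ : IsLevelFunction t₁) (ht₂ : IsLevelFunction t₂) :
    ∃ f' g' : C(E, X), (∀ p, dist (f p) (f' p) < ε) ∧ (∀ p, dist (g p) (g' p) < ε) ∧
      ∀ p q, t₁ p = t₂ q → f' p ≠ g' q := by
  obtain ⟨h₁, k₁, hk₁⟩ := ht₁
  obtain ⟨h₂, k₂, hk₂⟩ := ht₂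
  obtain ⟨A, hA⟩ := h₁.exists_forall_abs_le
  obtain ⟨B, hB⟩ := h₂.exists_forall_abs_le
  obtain ⟨C, hC⟩ := t₁.exists_forall_abs_le
  obtain ⟨D, hD⟩ := t₂.exists_forall_abs_le
  obtain ⟨γ, θ, hγ⟩ := exists_unitInterval_chart
    (M := |A| + |B| + |C| + |D| + 1) (by positivity)
  have hbound : ∀ {x : ℝ}, |x| ≤ A ∨ |x| ≤ B ∨ |x| ≤ C ∨ |x| ≤ D → γ (θ x) = x := by
    intro x hx
    apply hγ
    have := abs_nonneg A
    have := abs_nonneg B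
    have := abs_nonneg C
    have := abs_nonneg D
    have := le_abs_self A
    have := le_abs_self B
    have := le_abs_self C
    have := le_abs_self D
    rcases hx with hx | hx | hx | hx <;> linarith
  obtain ⟨F, G, hF, hG, hFG⟩ := hX ε hε
    (f.comp (k₁.comp (γ.prodMap γ))) (g.comp (k₂.comp (γ.prodMap γ)))
  refine ⟨F.comp ((θ.comp h₁).prodMk (θ.comp t₁)), G.comp ((θ.comp h₂).prodMk (θ.comp t₂)),
    fun p => ?_, fun p => ?_, fun p q hpq => ?_⟩
  · simpa [hbound (.inl (hA p)), hbound (.inr (.inr (.inl (hC p)))), hk₁]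
      using hF (θ (h₁ p), θ (t₁ p))
  · simpa [hbound (.inr (.inl (hB p))), hbound (.inr (.inr (.inr (hD p)))), hk₂]
      using hG (θ (h₂ p), θ (t₂ p))
  · simpa [hpq] using hFG (θ (t₂ q)) (θ (h₁ p)) (θ (h₂ q))

theorem exists_pos_forall_le_dist {f g : C(E, X)} {t₁ t₂ : C(E, ℝ)}
    (h : ∀ p q, t₁ p = t₂ q → f p ≠ g q) :
    ∃ δ > 0, ∀ p q, t₁ p = t₂ q → δ ≤ dist (f p) (g q) := by
  have hK : IsCompact {x : E × E | t₁ x.1 = t₂ x.2} :=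
    (isClosed_eq (by fun_prop) (by fun_prop)).isCompact
  rcases eq_empty_or_nonempty {x : E × E | t₁ x.1 = t₂ x.2} with he | hne
  · refine ⟨1, one_pos, fun p q hpq => ?_⟩
    have : (p, q) ∈ {x : E × E | t₁ x.1 = t₂ x.2} := hpq
    simp [he] at this
  · obtain ⟨x, hx, hmin⟩ := hK.exists_isMinOn hne
      (f := fun x : E × E => dist (f x.1) (g x.2)) (by fun_prop)
    exact ⟨_, dist_pos.2 (h _ _ hx), fun p q hpq => hmin (show (p, q) ∈ _ from hpq)⟩

theorem HasDHP.exists_separated_finset (hX : HasDHP X) (f g : C(E, X))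
    (S : Finset (C(E, ℝ) × C(E, ℝ)))
    (hS : ∀ t ∈ S, IsLevelFunction t.1 ∧ IsLevelFunction t.2) {ε : ℝ} (hε : 0 < ε) :
    ∃ f' g' : C(E, X), (∀ p, dist (f p) (f' p) < ε) ∧ (∀ p, dist (g p) (g' p) < ε) ∧
      ∃ δ > 0, ∀ t ∈ S, ∀ p q, t.1 p = t.2 q → δ ≤ dist (f' p) (g' q) := by
  classical
  induction S using Finset.induction_on generalizing ε with
  | empty => exact ⟨f, g, fun p => by simpa, fun p => by simpa, 1, one_pos, by simp⟩
  | insert t S _ ih =>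
    obtain ⟨f₁, g₁, hf₁, hg₁, δ₁, hδ₁, h₁⟩ :=
      ih (fun t ht => hS t (Finset.mem_insert_of_mem ht)) (half_pos hε)
    obtain ⟨ht₁, ht₂⟩ := hS t (Finset.mem_insert_self t S)
    obtain ⟨f₂, g₂, hf₂, hg₂, h₂⟩ := hX.exists_separated
      (lt_min (half_pos hε) (show 0 < δ₁ / 4 by positivity)) f₁ g₁ ht₁ ht₂
    obtain ⟨δ₂, hδ₂, h₃⟩ := exists_pos_forall_le_dist h₂
    refine ⟨f₂, g₂, fun p => ?_, fun p => ?_, min δ₂ (δ₁ / 2),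
      lt_min hδ₂ (half_pos hδ₁), fun s hs p q hpq => ?_⟩
    · linarith [dist_triangle (f p) (f₁ p) (f₂ p), hf₁ p, (lt_min_iff.1 (hf₂ p)).1]
    · linarith [dist_triangle (g p) (g₁ p) (g₂ p), hg₁ p, (lt_min_iff.1 (hg₂ p)).1]
    · rcases Finset.mem_insert.1 hs with rfl | hs
      · exact (min_le_left _ _).trans (h₃ p q hpq)
      · refine (min_le_right _ _).trans ?_
        have := h₁ s hs p q hpq
        linarith [dist_triangle4 (f₁ p) (f₂ p) (g₂ q) (g₁ q), dist_comm (g₂ q) (g₁ q),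
          (lt_min_iff.1 (hf₂ p)).2, (lt_min_iff.1 (hg₂ q)).2]

theorem HasDHP.exists_disjoint_prod_real (hX : HasDHP X)
    (hE : closure (piecewiseLevel E) = univ) {ε : ℝ} (hε : 0 < ε) (f g : C(E, X × ℝ)) :
    ∃ f' g' : C(E, X × ℝ), (∀ p, dist (f p) (f' p) < ε) ∧ (∀ p, dist (g p) (g' p) < ε) ∧
      range f' ∩ range g' = ∅ := by
  have happrox (w : C(E, ℝ)) : ∃ u ∈ piecewiseLevel E, ∀ p, dist (w p) (u p) < ε := by
    obtain ⟨u, hu, hwu⟩ := Metric.mem_closure_iff.1 (hE ▸ mem_univ w) ε hε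
    exact ⟨u, hu, fun p => (ContinuousMap.dist_apply_le_dist p).trans_lt hwu⟩
  obtain ⟨u, ⟨F, hF, hu⟩, hfu⟩ := happrox (ContinuousMap.snd.comp f)
  obtain ⟨v, ⟨G, hG, hv⟩, hgv⟩ := happrox (ContinuousMap.snd.comp g)
  obtain ⟨f', g', hf', hg', δ, hδ, h⟩ := hX.exists_separated_finset
    (ContinuousMap.fst.comp f) (ContinuousMap.fst.comp g) (F ×ˢ G)
    (fun t ht => ⟨hF _ (Finset.mem_product.1 ht).1, hG _ (Finset.mem_product.1 ht).2⟩) hε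
  refine ⟨f'.prodMk u, g'.prodMk v, fun p => ?_, fun p => ?_, ?_⟩
  · exact Prod.dist_eq.trans_lt (max_lt (hf' p) (hfu p))
  · exact Prod.dist_eq.trans_lt (max_lt (hg' p) (hgv p))
  · rw [← disjoint_iff_inter_eq_empty, disjoint_left]
    rintro _ ⟨p, rfl⟩ ⟨q, hq⟩
    obtain ⟨hX', huv⟩ := Prod.ext_iff.1 hq
    obtain ⟨t₁, ht₁, hut⟩ := hu p
    obtain ⟨t₂, ht₂, hvt⟩ := hv q
    have hle := h (t₁, t₂) (Finset.mk_mem_product ht₁ ht₂) p q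
      (hut.symm.trans (huv.symm.trans hvt))
    have hz : g' q = f' p := hX'
    rw [hz, dist_self] at hle
    exact hδ.not_ge hle

theorem closure_piecewiseLevel_eq_univ [Nonempty E]
    (h : {t : C(E, ℝ) | IsLevelFunction t}.SeparatesPointsStrongly) :
    closure (piecewiseLevel E) = univ := by
  classical
  have hsub : ∀ t : C(E, ℝ), IsLevelFunction t → t ∈ piecewiseLevel E := fun t ht =>
    ⟨{t}, by simpa using ht, by simp⟩
  have hsep : (piecewiseLevel E).SeparatesPointsStrongly := fun v x y =>
    let ⟨t, ht, hxy⟩ := h v x y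
    ⟨t, hsub t ht, hxy⟩
  refine ContinuousMap.sublattice_closure_eq_top _ ?_ ?_ ?_ hsep
  · obtain ⟨x⟩ := ‹Nonempty E›
    obtain ⟨t, ht, -⟩ := hsep 0 x x
    exact ⟨t, ht⟩
  all_goals
    rintro u ⟨F, hF, hu⟩ v ⟨G, hG, hv⟩
    refine ⟨F ∪ G, fun t ht => (Finset.mem_union.1 ht).elim (hF t) (hG t), fun p => ?_⟩
    obtain ⟨t, ht, hut⟩ := hu p
    obtain ⟨s, hs, hvs⟩ := hv p
    rcases le_total (u p) (v p) with hle | hle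
  · exact ⟨t, Finset.mem_union_left _ ht, by simpa [hle] using hut⟩
  · exact ⟨s, Finset.mem_union_right _ hs, by simpa [hle] using hvs⟩
  · exact ⟨s, Finset.mem_union_right _ hs, by simpa [hle] using hvs⟩
  · exact ⟨t, Finset.mem_union_left _ ht, by simpa [hle] using hut⟩

end Separation

instance : CompactSpace Disk2 :=
  isCompact_iff_compactSpace.1 (isCompact_closedBall _ _)

instance : Nonempty Disk2 := ⟨⟨0, by simp [Disk2]⟩⟩

theorem exists_retraction_disk2 :
    ∃ r : C(EuclideanSpace ℝ (Fin 2), Disk2), ∀ p : Disk2, r p = p := by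
  have hpos : ∀ x : EuclideanSpace ℝ (Fin 2), 0 < max 1 ‖x‖ := fun x =>
    one_pos.trans_le (le_max_left _ _)
  refine ⟨⟨fun x => ⟨(max 1 ‖x‖)⁻¹ • x, ?_⟩, ?_⟩, fun p => ?_⟩
  · rw [Disk2, mem_closedBall_zero_iff, norm_smul, norm_inv, Real.norm_of_nonneg (hpos x).le,
      inv_mul_le_iff₀ (hpos x), mul_one]
    exact le_max_right _ _
  · exact Continuous.subtype_mk (((continuous_const.max continuous_norm).inv₀
      fun x => (hpos x).ne').smul continuous_id) _
  · have hp : ‖(p : EuclideanSpace ℝ (Fin 2))‖ ≤ 1 := mem_closedBall_zero_iff.1 p.2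
    ext1
    simp [max_eq_left hp]

/-- The restriction to the disk of the affine function `x ↦ a * x 0 + b * x 1 + c`. -/
def diskAffine (a b c : ℝ) : C(Disk2, ℝ) where
  toFun p := a * p.1 0 + b * p.1 1 + c

theorem isLevelFunction_diskAffine {a b : ℝ} (c : ℝ) (hab : a ^ 2 + b ^ 2 ≠ 0) :
    IsLevelFunction (diskAffine a b c) := by
  obtain ⟨r, hr⟩ := exists_retraction_disk2
  refine ⟨diskAffine (-b) a 0, r.comp ⟨fun y =>
    !₂[((y.2 - c) * a - y.1 * b) / (a ^ 2 + b ^ 2),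
      ((y.2 - c) * b + y.1 * a) / (a ^ 2 + b ^ 2)], by fun_prop⟩, fun p => ?_⟩
  refine Eq.trans (congrArg r ?_) (hr p)
  ext i
  fin_cases i <;> simp [diskAffine] <;> field_simp <;> ring

theorem separatesPointsStrongly_isLevelFunction_disk2 :
    {t : C(Disk2, ℝ) | IsLevelFunction t}.SeparatesPointsStrongly := by
  intro v x y
  have key : ∃ a b : ℝ, a ^ 2 + b ^ 2 ≠ 0 ∧
      a * (y.1 0 - x.1 0) + b * (y.1 1 - x.1 1) = v y - v x := by
    by_cases hv : v y - v x = 0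
    · by_cases hd : (y.1 1 - x.1 1) ^ 2 + (-(y.1 0 - x.1 0)) ^ 2 = 0
      · have h0 : y.1 0 - x.1 0 = 0 := by nlinarith [sq_nonneg (y.1 1 - x.1 1)]
        have h1 : y.1 1 - x.1 1 = 0 := by nlinarith [sq_nonneg (y.1 0 - x.1 0)]
        exact ⟨1, 0, by norm_num, by simp [h0, hv]⟩
      · exact ⟨_, _, hd, by rw [hv]; ring⟩
    · have hd : (y.1 0 - x.1 0) ^ 2 + (y.1 1 - x.1 1) ^ 2 ≠ 0 := by
        intro hd
        have h0 : y.1 0 - x.1 0 = 0 := by nlinarith [sq_nonneg (y.1 1 - x.1 1)]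
        have h1 : y.1 1 - x.1 1 = 0 := by nlinarith [sq_nonneg (y.1 0 - x.1 0)]
        have hxy : x = y := by
          ext i
          fin_cases i
          · exact (sub_eq_zero.1 h0).symm
          · exact (sub_eq_zero.1 h1).symm
        exact hv (by rw [hxy, sub_self])
      set d := (y.1 0 - x.1 0) ^ 2 + (y.1 1 - x.1 1) ^ 2 with hdef
      have heq : (v y - v x) * (y.1 0 - x.1 0) / d * (y.1 0 - x.1 0) +
          (v y - v x) * (y.1 1 - x.1 1) / d * (y.1 1 - x.1 1) = v y - v x := by
        field_simp
        rw [hdef]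
      refine ⟨_, _, fun h0 => hv ?_, heq⟩
      rw [← heq, pow_eq_zero_iff two_ne_zero |>.1 (add_eq_zero_iff_of_nonneg (sq_nonneg _)
        (sq_nonneg _) |>.1 h0).1, pow_eq_zero_iff two_ne_zero |>.1
        (add_eq_zero_iff_of_nonneg (sq_nonneg _) (sq_nonneg _) |>.1 h0).2]
      ring
  obtain ⟨a, b, hab, h⟩ := key
  refine ⟨diskAffine a b (v x - a * x.1 0 - b * x.1 1), isLevelFunction_diskAffine _ hab, ?_, ?_⟩
  · simp [diskAffine]
  · simp only [diskAffine, ContinuousMap.coe_mk]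
    linarith

/-- (Edwards, Halverson) If a locally compact metric ANR `X` has the disjoint
homotopies property, then `X × ℝ` has the disjoint disks property. -/
theorem dhp_implies_ddp_times_R (X : Type*) [MetricSpace X]
    [LocallyCompactSpace X] (hanr : IsANR X) (hdhp : HasDHP X) :
    HasDDP (X × ℝ) := fun _ hε f g =>
  hdhp.exists_disjoint_prod_real
    (closure_piecewiseLevel_eq_univ separatesPointsStrongly_isLevelFunction_disk2) hε f g
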